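/- Let M be a Lie ideal of L, let S be a subspace of L with L = M ⊕ S as vector spaces, let z be a nonzero element of the center Z(M) of M, and let φ : S × S → k be a nondegenerate alternating bilinear form, such that ⁅x,s⁆ = 0 for all x ∈ M, s ∈ S, and ⁅s,t⁆ = φ(s,t)·z for all s,t ∈ S. Then: (i) i(L) = i(M) and Z(L) = Z(M); (ii) M is square integrable if and only if L is square integrable; (iii) if M has a CP (resp. a CP-ideal), then so does L. -/

import Mathlib

open Module

noncomputable section

variable (k : Type*) [Field k]

/-- `L(f) = {x ∈ L | f ⁅x, y⁆ = 0 for all y ∈ L}`. -/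
def lieStab (L : Type*) [LieRing L] [LieAlgebra k L] (f : Module.Dual k L) :
    Submodule k L where
  carrier := {x | ∀ y : L, f ⁅x, y⁆ = 0}
  add_mem' := fun {a b} ha hb y => by rw [add_lie, map_add, ha y, hb y, add_zero]
  zero_mem' := fun y => by rw [zero_lie, map_zero]
  smul_mem' := fun c a ha y => by rw [smul_lie, map_smul, ha y, smul_zero]

/-- The index `i(L)`, the minimum of `dim L(f)` over all `f ∈ L*`. -/
def lieIndex (L : Type*) [LieRing L] [LieAlgebra k L] : ℕ :=
  ⨅ f : Module.Dual k L, finrank k (lieStab k L f)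

/-- `f ∈ L*` is regular if `dim L(f) = i(L)`. -/
def LieIsRegular (L : Type*) [LieRing L] [LieAlgebra k L] (f : Module.Dual k L) : Prop :=
  finrank k (lieStab k L f) = lieIndex k L

/-- A commutative polarization of `L`: an abelian Lie subalgebra `P` with
`2 dim P = dim L + i(L)`. -/
def IsCP (L : Type*) [LieRing L] [LieAlgebra k L] (P : LieSubalgebra k L) : Prop :=
  IsLieAbelian ↥P ∧ 2 * finrank k ↥P = finrank k L + lieIndex k L

/-- A CP-ideal of `L`: a CP which is also a Lie ideal of `L`. -/
def IsCPIdeal (L : Type*) [LieRing L] [LieAlgebra k L] (P : LieSubalgebra k L) : Prop :=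
  IsCP k L P ∧ ∀ x y : L, y ∈ P → ⁅x, y⁆ ∈ P

/-- `L` is square integrable if `i(L) = dim Z(L)`. -/
def SquareIntegrable (L : Type*) [LieRing L] [LieAlgebra k L] : Prop :=
  lieIndex k L = finrank k ↥(LieAlgebra.center k L)


section

variable {k}

section Linear

variable {V W : Type*} [AddCommGroup V] [Module k V] [FiniteDimensional k V]
  [AddCommGroup W] [Module k W]

/-- In a linear pencil `B - μ A` the rank drops below the rank of `A` for only finitely many `μ`. -/
theorem exists_finrank_ker_sub_smul_le [Infinite k] (A B : V →ₗ[k] W) :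
    ∃ μ : k, finrank k (LinearMap.ker (B - μ • A)) ≤ finrank k (LinearMap.ker A) := by
  obtain ⟨U, hU⟩ := (LinearMap.ker A).exists_isCompl
  have hAU : LinearMap.ker (A ∘ₗ U.subtype) = ⊥ := by
    rw [LinearMap.ker_comp, ← Submodule.disjoint_iff_comap_eq_bot]
    exact hU.disjoint.symm
  obtain ⟨C, hC⟩ := (A ∘ₗ U.subtype).exists_leftInverse_of_injective hAU
  obtain ⟨μ, hμ⟩ := (Module.End.finite_hasEigenvalue (C ∘ₗ B ∘ₗ U.subtype)).exists_notMem
  refine ⟨μ, ?_⟩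
  have hdisj : Disjoint (LinearMap.ker (B - μ • A)) U := by
    rw [Submodule.disjoint_def]
    intro u hu huU
    by_contra hne
    have hCA : C (A u) = ⟨u, huU⟩ := LinearMap.congr_fun hC ⟨u, huU⟩
    refine hμ (Module.End.hasEigenvalue_of_hasEigenvector (x := (⟨u, huU⟩ : U))
      ⟨Module.End.mem_eigenspace_iff.2 ?_, by simpa [Subtype.ext_iff] using hne⟩)
    have hB : B u = μ • A u := by simpa [sub_eq_zero] using hu
    simp [hB, hCA]
  have h1 := Submodule.finrank_add_finrank_le_of_disjoint hdisj
  have h2 := Submodule.finrank_add_eq_of_isCompl hU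
  omega

/-- A nondegenerate alternating form admits a Lagrangian subspace. -/
theorem exists_isotropic_two_mul_finrank_eq (φ : LinearMap.BilinForm k V) (halt : φ.IsAlt)
    (hnd : LinearMap.ker φ = ⊥) :
    ∃ N : Submodule k V, (∀ s ∈ N, ∀ t ∈ N, φ s t = 0) ∧ 2 * finrank k N = finrank k V := by
  obtain ⟨N, hN, hmax⟩ := (wellFounded_gt (α := Submodule k V)).has_min
    {N | ∀ s ∈ N, ∀ t ∈ N, φ s t = 0} ⟨⊥, by simp⟩
  refine ⟨N, hN, ?_⟩
  have horth : φ.orthogonal N = N := by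
    refine le_antisymm (fun v hv => ?_) fun t ht s hs => hN s hs t ht
    by_contra hvN
    have hv' : ∀ s ∈ N, φ s v = 0 := hv
    refine hmax (N ⊔ Submodule.span k {v}) ?_ ?_
    · intro s hs t ht
      obtain ⟨a, ha, c, hc, rfl⟩ := Submodule.mem_sup.1 hs
      obtain ⟨b, hb, d, hd, rfl⟩ := Submodule.mem_sup.1 ht
      obtain ⟨c, rfl⟩ := Submodule.mem_span_singleton.1 hc
      obtain ⟨d, rfl⟩ := Submodule.mem_span_singleton.1 hd
      simp [hN a ha b hb, hv' a ha, halt.isRefl _ _ (hv' b hb), halt.self_eq_zero]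
    · exact left_lt_sup.2 fun h => hvN (h (Submodule.mem_span_singleton_self v))
  have h := LinearMap.BilinForm.finrank_add_finrank_orthogonal' (B := φ) N
  rw [horth, hnd, inf_bot_eq, finrank_bot] at h
  omega

end Linear

section Index

variable {L : Type*} [LieRing L] [LieAlgebra k L]

/-- The alternating form `(x, y) ↦ f ⁅x, y⁆`. -/
def lieForm : Module.Dual k L →ₗ[k] LinearMap.BilinForm k L :=
  LinearMap.lcomp k (Module.Dual k L) (LieModule.toEnd k L L : L →ₗ[k] Module.End k L) ∘ₗ
    LinearMap.llcomp k L L k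

theorem ker_lieForm (f : Module.Dual k L) : LinearMap.ker (lieForm f) = lieStab k L f := by
  ext x
  rw [LinearMap.mem_ker, LinearMap.ext_iff]
  rfl

theorem lieIndex_le (f : Module.Dual k L) : lieIndex k L ≤ finrank k (lieStab k L f) :=
  ciInf_le (OrderBot.bddBelow _) f

theorem exists_lieIsRegular : ∃ f : Module.Dual k L, LieIsRegular k L f :=
  ciInf_mem fun f : Module.Dual k L => finrank k (lieStab k L f)

theorem IsCP.lie_eq_zero {P : LieSubalgebra k L} (hP : IsCP k L P) {x y : L} (hx : x ∈ P)
    (hy : y ∈ P) : ⁅x, y⁆ = 0 := by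
  have := hP.1
  exact congrArg Subtype.val (trivial_lie_zero P P ⟨x, hx⟩ ⟨y, hy⟩)

variable [FiniteDimensional k L]

theorem exists_lieIsRegular_apply_ne_zero [Infinite k] {z : L} (hz : z ≠ 0) :
    ∃ f : Module.Dual k L, LieIsRegular k L f ∧ f z ≠ 0 := by
  obtain ⟨g, hg⟩ := exists_lieIsRegular (k := k) (L := L)
  by_cases hgz : g z = 0
  · obtain ⟨h, hhz⟩ : ∃ h : Module.Dual k L, h z ≠ 0 := by
      by_contra! hall
      exact hz ((Module.forall_dual_apply_eq_zero_iff k z).1 hall)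
    obtain ⟨μ, hμ⟩ := exists_finrank_ker_sub_smul_le (lieForm g) (lieForm h)
    have hpencil : lieForm h - μ • lieForm g = lieForm (h - μ • g) := rfl
    rw [hpencil, ker_lieForm, ker_lieForm, hg] at hμ
    exact ⟨h - μ • g, hμ.antisymm (lieIndex_le _), by simpa [hgz] using hhz⟩
  · exact ⟨g, hg, hgz⟩

theorem two_mul_finrank_le_of_lie_eq_zero (V : Submodule k L)
    (hV : ∀ x ∈ V, ∀ y ∈ V, ⁅x, y⁆ = 0) :
    2 * finrank k V ≤ finrank k L + lieIndex k L := by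
  obtain ⟨f, hf⟩ := exists_lieIsRegular (k := k) (L := L)
  have h := LinearMap.BilinForm.finrank_add_finrank_orthogonal' (B := lieForm f) V
  have h1 : finrank k V ≤ finrank k ((lieForm f).orthogonal V) :=
    Submodule.finrank_mono fun y hy x hx => by
      change f ⁅x, y⁆ = 0
      rw [hV x hx y hy, map_zero]
  have h2 : finrank k (V ⊓ LinearMap.ker (lieForm f) : Submodule k L) ≤ lieIndex k L := by
    rw [← hf, ← ker_lieForm]
    exact Submodule.finrank_mono inf_le_right
  omega

/-- A commutative polarization contains the center. -/
theorem IsCP.mem_of_mem_center {P : LieSubalgebra k L} (hP : IsCP k L P) {z : L}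
    (hz : ∀ y : L, ⁅z, y⁆ = 0) : z ∈ P := by
  by_contra hzP
  have hz' : ∀ y : L, ⁅y, z⁆ = 0 := fun y => by rw [← lie_skew, hz, neg_zero]
  have hle := two_mul_finrank_le_of_lie_eq_zero (P.toSubmodule ⊔ Submodule.span k {z}) (by
    intro x hx y hy
    obtain ⟨a, ha, c, hc, rfl⟩ := Submodule.mem_sup.1 hx
    obtain ⟨b, hb, d, hd, rfl⟩ := Submodule.mem_sup.1 hy
    obtain ⟨c, rfl⟩ := Submodule.mem_span_singleton.1 hc
    obtain ⟨d, rfl⟩ := Submodule.mem_span_singleton.1 hd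
    simp [hz, hz', hP.lie_eq_zero ha hb])
  have hlt : finrank k P.toSubmodule < _ := Submodule.finrank_lt_finrank_of_lt
    (left_lt_sup.2 fun h => hzP (h (Submodule.mem_span_singleton_self z)))
  have hdim : 2 * finrank k P.toSubmodule = finrank k L + lieIndex k L := hP.2
  omega

end Index

end

/-- **Proposition 7.3.** Let `M` be a Lie ideal of `L`, `S` a vector space complement of `M`
in `L`, `z` a nonzero central element of `M` and `φ` a nondegenerate alternating bilinear
form on `S` such that `⁅M, S⁆ = 0` and `⁅s, t⁆ = φ(s,t) z` for `s, t ∈ S`.  Then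
(i) `i(L) = i(M)` and `Z(L) = Z(M)`; (ii) `M` is square integrable iff `L` is;
(iii) if `M` has a CP (resp. a CP-ideal), then so does `L`. -/
theorem heisenberg_extension {k L : Type*} [Field k] [CharZero k]
    [LieRing L] [LieAlgebra k L] [FiniteDimensional k L] (M : LieSubalgebra k L)
    (hMideal : ∀ x y : L, y ∈ M → ⁅x, y⁆ ∈ M) (S : Submodule k L)
    (hinf : M.toSubmodule ⊓ S = ⊥) (hsup : M.toSubmodule ⊔ S = ⊤)
    (z : L) (hzM : z ∈ M) (hz0 : z ≠ 0) (hzc : ∀ y ∈ M, ⁅z, y⁆ = 0)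
    (φ : ↥S →ₗ[k] ↥S →ₗ[k] k)
    (hφalt : ∀ s : ↥S, φ s s = 0)
    (hφnd : ∀ s : ↥S, (∀ t : ↥S, φ s t = 0) → s = 0)
    (hMS : ∀ x ∈ M, ∀ s ∈ S, ⁅x, s⁆ = (0 : L))
    (hSS : ∀ s t : ↥S, ⁅(s : L), (t : L)⁆ = φ s t • z) :
    (lieIndex k L = lieIndex k ↥M ∧
      (∀ x : L, x ∈ LieAlgebra.center k L ↔
        ∃ hx : x ∈ M, (⟨x, hx⟩ : ↥M) ∈ LieAlgebra.center k ↥M)) ∧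
    (SquareIntegrable k ↥M ↔ SquareIntegrable k L) ∧
    ((∃ P : LieSubalgebra k ↥M, IsCP k ↥M P) → ∃ P : LieSubalgebra k L, IsCP k L P) ∧
    ((∃ P : LieSubalgebra k ↥M, IsCPIdeal k ↥M P) →
      ∃ P : LieSubalgebra k L, IsCPIdeal k L P) := by
  have hdec : ∀ x : L, ∃ m ∈ M, ∃ s ∈ S, m + s = x := fun x =>
    Submodule.mem_sup.1 (hsup ▸ Submodule.mem_top (x := x))
  have hSM : ∀ s ∈ S, ∀ x ∈ M, ⁅s, x⁆ = (0 : L) := fun s hs x hx => by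
    rw [← lie_skew, hMS x hx s hs, neg_zero]
  have hstab_le : ∀ f : Module.Dual k L,
      (lieStab k ↥M (f ∘ₗ M.toSubmodule.subtype)).map M.toSubmodule.subtype ≤ lieStab k L f := by
    rintro f _ ⟨x, hx, rfl⟩ y
    obtain ⟨m, hm, s, hs, rfl⟩ := hdec y
    have h1 : f ⁅(x : L), m⁆ = 0 := hx ⟨m, hm⟩
    have h2 : ⁅(x : L), s⁆ = 0 := hMS x x.2 s hs
    rw [lie_add, map_add]
    exact (congrArg₂ (· + ·) h1 (by rw [← map_zero f, ← h2]; rfl)).trans (add_zero 0)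
  have hstab_ge : ∀ f : Module.Dual k L, f z ≠ 0 → lieStab k L f ≤
      (lieStab k ↥M (f ∘ₗ M.toSubmodule.subtype)).map M.toSubmodule.subtype := by
    intro f hfz x hx
    obtain ⟨m, hm, s, hs, rfl⟩ := hdec x
    have hs0 : (⟨s, hs⟩ : S) = 0 := hφnd _ fun t => by
      have h := hx t
      rw [add_lie, hMS m hm t t.2, zero_add, hSS ⟨s, hs⟩ t, map_smul, smul_eq_mul] at h
      exact (mul_eq_zero.1 h).resolve_right hfz
    obtain rfl : s = 0 := congrArg Subtype.val hs0
    rw [add_zero] at hx ⊢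
    exact ⟨⟨m, hm⟩, fun y => hx y, rfl⟩
  have hstab_finrank : ∀ g : Module.Dual k ↥M,
      finrank k ((lieStab k ↥M g).map M.toSubmodule.subtype) = finrank k (lieStab k ↥M g) :=
    fun g => Submodule.finrank_map_subtype_eq M.toSubmodule _
  have hindex : lieIndex k L = lieIndex k ↥M := by
    apply le_antisymm
    · obtain ⟨g, hg, hgz⟩ := exists_lieIsRegular_apply_ne_zero (k := k)
        (z := (⟨z, hzM⟩ : M)) (by simpa [Subtype.ext_iff] using hz0)
      obtain ⟨f, rfl⟩ : ∃ f : Module.Dual k L, f ∘ₗ M.toSubmodule.subtype = g :=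
        LinearMap.exists_extend (p := M.toSubmodule) g
      refine (lieIndex_le f).trans ?_
      rw [← hg, ← hstab_finrank]
      exact Submodule.finrank_mono (hstab_ge f hgz)
    · obtain ⟨f, hf⟩ := exists_lieIsRegular (k := k) (L := L)
      refine (lieIndex_le (f ∘ₗ M.toSubmodule.subtype)).trans ?_
      rw [← hf, ← hstab_finrank]
      exact Submodule.finrank_mono (hstab_le f)
  have hcenter : ∀ x : L, x ∈ LieAlgebra.center k L ↔
      ∃ hx : x ∈ M, (⟨x, hx⟩ : ↥M) ∈ LieAlgebra.center k ↥M := by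
    intro x
    simp only [LieModule.mem_maxTrivSubmodule]
    constructor
    · intro hx
      obtain ⟨m, hm, s, hs, rfl⟩ := hdec x
      have hs0 : (⟨s, hs⟩ : S) = 0 := hφnd _ fun t => by
        have h := hx t
        rw [← lie_skew, add_lie, hMS m hm t t.2, zero_add, hSS ⟨s, hs⟩ t, neg_eq_zero] at h
        exact (smul_eq_zero.1 h).resolve_right hz0
      obtain rfl : s = 0 := congrArg Subtype.val hs0
      rw [add_zero] at hx ⊢
      exact ⟨hm, fun y => Subtype.ext (hx y)⟩
    · rintro ⟨hxM, hx⟩ y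
      obtain ⟨m, hm, s, hs, rfl⟩ := hdec y
      rw [add_lie, hSM s hs x hxM, add_zero]
      exact congrArg Subtype.val (hx ⟨m, hm⟩)
  have hcenter_finrank :
      finrank k ↥(LieAlgebra.center k L) = finrank k ↥(LieAlgebra.center k ↥M) := by
    have hmap : (LieAlgebra.center k L).toSubmodule =
        (LieAlgebra.center k ↥M).toSubmodule.map M.toSubmodule.subtype := by
      ext x
      refine (hcenter x).trans ⟨fun ⟨hx, h⟩ => ⟨⟨x, hx⟩, h, rfl⟩, ?_⟩
      rintro ⟨y, hy, rfl⟩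
      exact ⟨y.2, hy⟩
    exact (congrArg (fun V : Submodule k L => finrank k V) hmap).trans
      (Submodule.finrank_map_subtype_eq M.toSubmodule _)
  obtain ⟨N, hN, hNdim⟩ := exists_isotropic_two_mul_finrank_eq φ hφalt
    ((Submodule.eq_bot_iff _).2 fun s hs => hφnd s fun t => by
      rw [LinearMap.mem_ker.1 hs, LinearMap.zero_apply])
  have hCP : ∀ P : LieSubalgebra k ↥M, IsCP k ↥M P → ∃ Q : LieSubalgebra k L, IsCP k L Q ∧
      Q.toSubmodule = P.toSubmodule.map M.toSubmodule.subtype ⊔ N.map S.subtype := by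
    intro P hP
    have hQ : ∀ x ∈ P.toSubmodule.map M.toSubmodule.subtype ⊔ N.map S.subtype,
        ∀ y ∈ P.toSubmodule.map M.toSubmodule.subtype ⊔ N.map S.subtype, ⁅x, y⁆ = 0 := by
      intro x hx y hy
      obtain ⟨_, ⟨p, hp, rfl⟩, _, ⟨s, hs, rfl⟩, rfl⟩ := Submodule.mem_sup.1 hx
      obtain ⟨_, ⟨q, hq, rfl⟩, _, ⟨t, ht, rfl⟩, rfl⟩ := Submodule.mem_sup.1 hy
      have hpq : ⁅(p : L), (q : L)⁆ = 0 := congrArg Subtype.val (hP.lie_eq_zero hp hq)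
      have hst : ⁅(s : L), (t : L)⁆ = 0 := by rw [hSS, hN s hs t ht, zero_smul]
      have hpt : ⁅(p : L), (t : L)⁆ = 0 := hMS p p.2 t t.2
      have hsq : ⁅(s : L), (q : L)⁆ = 0 := hSM s s.2 q q.2
      change ⁅(p : L) + s, (q : L) + t⁆ = 0
      simp only [add_lie, lie_add, hpq, hst, hpt, hsq, add_zero]
    refine ⟨⟨_, fun {x y} hx hy => ?_⟩, ⟨⟨fun x y => Subtype.ext (hQ x x.2 y y.2)⟩, ?_⟩, rfl⟩
    · rw [hQ x hx y hy]
      exact Submodule.zero_mem _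
    · have hdim := Submodule.finrank_sup_add_finrank_inf_eq
        (P.toSubmodule.map M.toSubmodule.subtype) (N.map S.subtype)
      have hbot : P.toSubmodule.map M.toSubmodule.subtype ⊓ N.map S.subtype = ⊥ :=
        le_bot_iff.1 (hinf ▸ inf_le_inf (Submodule.map_subtype_le _ _)
          (Submodule.map_subtype_le _ _))
      have hPdim : finrank k (P.toSubmodule.map M.toSubmodule.subtype) =
        finrank k P.toSubmodule := Submodule.finrank_map_subtype_eq _ _
      have hN' : finrank k (N.map S.subtype) = finrank k N :=
        Submodule.finrank_map_subtype_eq _ _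
      rw [hbot, finrank_bot, hPdim, hN', add_zero] at hdim
      have hL := Submodule.finrank_add_eq_of_isCompl
        (IsCompl.of_eq hinf hsup)
      have hP2 : 2 * finrank k P.toSubmodule = finrank k M.toSubmodule + lieIndex k ↥M := hP.2
      change 2 * finrank k (P.toSubmodule.map M.toSubmodule.subtype ⊔ N.map S.subtype :
        Submodule k L) = _
      omega
  refine ⟨⟨hindex, hcenter⟩, ?_, fun ⟨P, hP⟩ => (hCP P hP).imp fun _ h => h.1, ?_⟩
  · rw [SquareIntegrable, SquareIntegrable, hindex, hcenter_finrank]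
  · rintro ⟨P, hP, hPideal⟩
    obtain ⟨Q, hQ, hQeq⟩ := hCP P hP
    have hmem : ∀ x : L, x ∈ Q ↔
        x ∈ P.toSubmodule.map M.toSubmodule.subtype ⊔ N.map S.subtype := fun x => by
      rw [← hQeq]; rfl
    have hzP : (⟨z, hzM⟩ : M) ∈ P := hP.mem_of_mem_center fun y => Subtype.ext (hzc y y.2)
    refine ⟨Q, hQ, fun x y hy => ?_⟩
    rw [hmem] at hy ⊢
    apply Submodule.mem_sup_left
    obtain ⟨m, hm, s, hs, rfl⟩ := hdec x
    obtain ⟨_, ⟨q, hq, rfl⟩, _, ⟨t, ht, rfl⟩, rfl⟩ := Submodule.mem_sup.1 hy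
    have hmt : ⁅m, (t : L)⁆ = 0 := hMS m hm t t.2
    have hsq : ⁅s, (q : L)⁆ = 0 := hSM s hs q q.2
    have hst : ⁅s, (t : L)⁆ = φ ⟨s, hs⟩ t • z := hSS ⟨s, hs⟩ t
    refine ⟨⁅⟨m, hm⟩, q⁆ + φ ⟨s, hs⟩ t • ⟨z, hzM⟩,
      P.toSubmodule.add_mem (hPideal _ _ hq) (P.toSubmodule.smul_mem _ hzP), ?_⟩
    change ⁅m, (q : L)⁆ + φ ⟨s, hs⟩ t • z = ⁅m + s, (q : L) + t⁆
    simp only [add_lie, lie_add, hmt, hsq, hst, add_zero, zero_add]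

end
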